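/- arXiv:2410.16968 — 2 statements merged into one kernel-verified Lean document; each statement's English description precedes it below -/
import Mathlib

section
/- Let σ ≥ 2 and 1 ≤ w ≤ k. Then DR_σ(k,w) = 2/(w+1) + Dev_σ(k,w)/σ^{w+k}, where Dev_σ(k,w) = Σ_{t=1}^{w} (1/t)·( Prim_σ(t) + Σ_{p=1}^{t−1} Prim_σ(p)·σ^{t−p}·( 2t−2p+1 − (4t−4p−1)/σ + (2t−2p−2)/σ² ) ) − (2/(w+1))·Σ_{p=1}^{w} Prim_σ(p)·σ^{w−p}·(w−p+1 − (w−p)/σ). -/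
open Finset

/-- The `i`-th length-`k` substring (`k`-mer) of a word of length `w + k`
over the alphabet `Fin σ`. -/
def kmerAt (σ k w : ℕ) (v : Fin (w + k) → Fin σ) (i : Fin (w + 1)) : Fin k → Fin σ :=
  fun j => v ⟨i.1 + j.1, by have h1 := i.2; have h2 := j.2; omega⟩

/-- `v` is a gamechanger with respect to the linear order (ranking) `ρ` on `k`-mers:
either its `k`-prefix is a `ρ`-minimal `k`-mer of `v`, or its `k`-suffix is a
`ρ`-minimal `k`-mer of `v` occurring exactly once in `v`. -/
def IsGC (σ k w : ℕ) (ρ : (Fin k → Fin σ) ≃ Fin (σ ^ k)) (v : Fin (w + k) → Fin σ) : Prop :=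
  (∀ i : Fin (w + 1), ρ (kmerAt σ k w v 0) ≤ ρ (kmerAt σ k w v i)) ∨
  ((∀ i : Fin (w + 1), ρ (kmerAt σ k w v (Fin.last w)) ≤ ρ (kmerAt σ k w v i)) ∧
    (∀ i : Fin (w + 1), kmerAt σ k w v i = kmerAt σ k w v (Fin.last w) → i = Fin.last w))

/-- `P_{σ,k}(v)`: the fraction of linear orders `ρ` on `σ`-ary `k`-strings for which
`v` is a gamechanger. -/
noncomputable def Pgc (σ k w : ℕ) (v : Fin (w + k) → Fin σ) : ℝ :=
  (Nat.card {ρ : (Fin k → Fin σ) ≃ Fin (σ ^ k) // IsGC σ k w ρ v} : ℝ) /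
    (Nat.card ((Fin k → Fin σ) ≃ Fin (σ ^ k)) : ℝ)

/-- `D_ρ`: the fraction of gamechangers among all `σ`-ary strings of length `w + k`. -/
noncomputable def Dens (σ k w : ℕ) (ρ : (Fin k → Fin σ) ≃ Fin (σ ^ k)) : ℝ :=
  (Nat.card {v : Fin (w + k) → Fin σ // IsGC σ k w ρ v} : ℝ) / ((σ : ℝ) ^ (w + k))

/-- `DR_σ(k,w)`: the expected density, i.e. the average of `D_ρ` over all orders `ρ`. -/
noncomputable def DR (σ k w : ℕ) : ℝ :=
  (∑ ρ : (Fin k → Fin σ) ≃ Fin (σ ^ k), Dens σ k w ρ) /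
    (Nat.card ((Fin k → Fin σ) ≃ Fin (σ ^ k)) : ℝ)

/-- `DFR_σ(k,w) = (w+1) · DR_σ(k,w)`, the expected density factor. -/
noncomputable def DFR (σ k w : ℕ) : ℝ := ((w : ℝ) + 1) * DR σ k w

/-- The number of distinct `k`-mers of `v`. -/
def numKmers (σ k w : ℕ) (v : Fin (w + k) → Fin σ) : ℕ :=
  (Finset.univ.image (kmerAt σ k w v)).card

/-- `Rep_{σ,k,w}`: the set of `σ`-ary strings of length `w + k` that contain two equal
`k`-substrings at distinct positions. -/
def RepSet (σ k w : ℕ) : Finset (Fin (w + k) → Fin σ) :=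
  Finset.univ.filter fun v =>
    ∃ i j : Fin (w + 1), i ≠ j ∧ kmerAt σ k w v i = kmerAt σ k w v j

/-- `Dev_σ(k,w)`, the deviation of the random order. -/
noncomputable def Dev (σ k w : ℕ) : ℝ :=
  (∑ v ∈ RepSet σ k w, Pgc σ k w v) - (2 / ((w : ℝ) + 1)) * ((RepSet σ k w).card : ℝ)

/-- `p` is a period of the string `s` (of length `n`): `s[i] = s[i+p]` whenever both
positions are inside `s`. -/
def HasPeriod (σ n : ℕ) (s : Fin n → Fin σ) (p : ℕ) : Prop :=
  ∀ (i : ℕ) (h : i + p < n), s ⟨i, by omega⟩ = s ⟨i + p, h⟩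

/-- A string is primitive if it is not of the form `u^m` with `m ≥ 2`, equivalently it
has no period that is a proper divisor of its length. -/
def IsPrimitive (σ n : ℕ) (s : Fin n → Fin σ) : Prop :=
  ¬ ∃ d, d ∣ n ∧ d < n ∧ HasPeriod σ n s d

/-- `Prim_σ(n)`: the number of primitive `σ`-ary strings of length `n`. -/
noncomputable def Prim (σ n : ℕ) : ℕ :=
  Nat.card {s : Fin n → Fin σ // IsPrimitive σ n s}

/-- The substring of `v` of length `ℓ` starting at (0-indexed) position `i`. -/
def subAt (σ n : ℕ) (v : Fin n → Fin σ) (i ℓ : ℕ) (h : i + ℓ ≤ n) : Fin ℓ → Fin σ :=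
  fun j => v ⟨i + j.1, by have := j.2; omega⟩

/-- A string is `p`-periodic if `p` is its minimal period and `p ≤ |s|/2`. -/
def IsPPeriodic (σ n : ℕ) (s : Fin n → Fin σ) (p : ℕ) : Prop :=
  1 ≤ p ∧ 2 * p ≤ n ∧ HasPeriod σ n s p ∧ ∀ q, 1 ≤ q → q < p → ¬ HasPeriod σ n s q

/-- The occurrence `v[i..i+ℓ)` is a run of period `p`: it is `p`-periodic and is not
contained in a longer `p`-periodic substring of `v`. -/
def IsRun (σ n : ℕ) (v : Fin n → Fin σ) (i ℓ p : ℕ) (h : i + ℓ ≤ n) : Prop :=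
  IsPPeriodic σ ℓ (subAt σ n v i ℓ h) p ∧
    ∀ (i' ℓ' : ℕ) (h' : i' + ℓ' ≤ n), i' ≤ i → i + ℓ ≤ i' + ℓ' → ℓ < ℓ' →
      ¬ IsPPeriodic σ ℓ' (subAt σ n v i' ℓ' h') p

/-- A major run: a run `x` of period `p` with `|x| ≥ |v|/2 + p`. -/
def IsMajorRun (σ n : ℕ) (v : Fin n → Fin σ) (i ℓ p : ℕ) (h : i + ℓ ≤ n) : Prop :=
  IsRun σ n v i ℓ p h ∧ n + 2 * p ≤ 2 * ℓ

def Per (x : ℕ → ℕ) (a b p : ℕ) : Prop := ∀ i, a ≤ i → i + p < b → x i = x (i + p)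

lemma Per.mono {x : ℕ → ℕ} {a b c d p : ℕ} (h : Per x a b p) (h1 : a ≤ c) (h2 : d ≤ b) :
    Per x c d p := fun i hi hj => h i (by omega) (by omega)

lemma Per.mul {x : ℕ → ℕ} {a b p : ℕ} (h : Per x a b p) (m : ℕ) :
    ∀ i, a ≤ i → i + m * p < b → x i = x (i + m * p) := by
  induction m with
  | zero => intro i _ _; simp
  | succ m ih =>
    intro i hi hj
    have e : i + (m + 1) * p = i + m * p + p := by ring
    rw [e] at hj ⊢
    rw [ih i hi (by omega)]
    exact h _ (by omega) hj

lemma Per.dvd {x : ℕ → ℕ} {a b p q : ℕ} (h : Per x a b p) (hd : p ∣ q) : Per x a b q := by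
  obtain ⟨m, rfl⟩ := hd
  intro i hi hj
  rw [mul_comm] at hj ⊢
  exact h.mul m i hi hj

lemma Per.modEq {x : ℕ → ℕ} {a b p i j : ℕ} (h : Per x a b p) (hi : a ≤ i) (hi' : i < b)
    (hj : a ≤ j) (hj' : j < b) (e : i ≡ j [MOD p]) : x i = x j := by
  wlog hij : i ≤ j generalizing i j
  · exact (this hj hj' hi hi' e.symm (by omega)).symm
  have hd : p ∣ j - i := (Nat.modEq_iff_dvd' hij).1 e
  have := (h.dvd hd) i hi (by omega)
  rwa [Nat.add_sub_cancel' hij] at this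

lemma fine_wilf {x : ℕ → ℕ} {a b : ℕ} : ∀ N p q : ℕ, p + q ≤ N → 1 ≤ p → 1 ≤ q → Per x a b p →
    Per x a b q → a + p + q ≤ b → Per x a b (Nat.gcd p q) := by
  intro N
  induction N with
  | zero => intro p q h1 h2; omega
  | succ N ih =>
    intro p q hN hp hq P Q hab
    wlog hpq : p ≤ q generalizing p q
    · rw [Nat.gcd_comm]
      exact this q p (by omega) hq hp Q P (by omega) (by omega)
    rcases hpq.eq_or_lt with rfl | hlt
    · simpa using P
    · have R : Per x a b (q - p) := by
        intro i hi hj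
        by_cases h : i + q < b
        · rw [Q i hi h]
          have := P (i + (q - p)) (by omega) (by omega)
          rw [this]; congr 1; omega
        · have h1 := P (i - p) (by omega) (by omega)
          have h2 := Q (i - p) (by omega) (by omega)
          rw [show i - p + p = i by omega] at h1
          rw [show i - p + q = i + (q - p) by omega] at h2
          rw [← h1, h2]
      have := ih p (q - p) (by omega) hp (by omega) P R (by omega)
      rwa [Nat.gcd_sub_self_right hlt.le] at this

lemma per_rep_up {x : ℕ → ℕ} {a b c q : ℕ} (h : Per x a b q) (hq : 1 ≤ q) (hc : a ≤ c)
    (hcb : c + q ≤ b) (i : ℕ) (hi : a ≤ i) (hi' : i < b) :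
    ∃ j, c ≤ j ∧ j < c + q ∧ i ≡ j [MOD q] ∧ x i = x j := by
  have key : ∃ j, c ≤ j ∧ j < c + q ∧ i ≡ j [MOD q] := by
    refine ⟨c + ((i + c * q - c) % q), by omega, ?_, ?_⟩
    · have := Nat.mod_lt (i + c * q - c) hq
      omega
    · have hcq : c ≤ c * q := Nat.le_mul_of_pos_right _ hq
      have e1 : (i + c * q - c) % q ≡ i + c * q - c [MOD q] := Nat.mod_modEq _ _
      have e2 := e1.add_left c
      rw [show c + (i + c * q - c) = i + c * q by omega] at e2
      refine Nat.ModEq.trans ?_ e2.symm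
      simp [Nat.ModEq]
  obtain ⟨j, h1, h2, h3⟩ := key
  exact ⟨j, h1, h2, h3, h.modEq hi hi' (by omega) (by omega) h3⟩

lemma per_extend {x : ℕ → ℕ} {a b c d g q : ℕ} (Q : Per x a b q) (G : Per x c d g) (hq : 1 ≤ q)
    (hg : g ∣ q) (h1 : a ≤ c) (h2 : d ≤ b) (h3 : c + q ≤ d) : Per x a b g := by
  intro i hi hj
  obtain ⟨j, j1, j2, j3, j4⟩ := per_rep_up Q hq h1 (by omega) i hi (by omega)
  obtain ⟨l, l1, l2, l3, l4⟩ := per_rep_up Q hq h1 (by omega) (i + g) (by omega) hj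
  rw [j4, l4]
  refine G.modEq j1 (by omega) l1 (by omega) ?_
  have a1 := (j3.of_dvd hg).symm
  have a2 := l3.of_dvd hg
  refine a1.trans (Nat.ModEq.trans ?_ a2)
  simp [Nat.ModEq]

/-- `p` is the minimal distance of equal kmers. -/
def MinP (k w : ℕ) (x : ℕ → ℕ) (p : ℕ) : Prop :=
  1 ≤ p ∧ (∃ i, i + p ≤ w ∧ Per x i (i + p + k) p) ∧
    ∀ q, 1 ≤ q → q < p → ∀ i, i + q ≤ w → ¬ Per x i (i + q + k) q

lemma MinP.key {k w : ℕ} {x : ℕ → ℕ} {p : ℕ} (hwk : w ≤ k) (h : MinP k w x p) {q j : ℕ}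
    (hq : 1 ≤ q) (hj : j + q ≤ w) (Q : Per x j (j + q + k) q) :
    p ∣ q ∧ Per x j (j + q + k) p := by
  obtain ⟨hp, ⟨i, hi, P⟩, hmin⟩ := h
  have hb1 : max i j ≤ w := by omega
  have G : Per x (max i j) (min (i + p + k) (j + q + k)) (Nat.gcd p q) := by
    apply fine_wilf (p + q) p q le_rfl hp hq (P.mono (by omega) (by omega))
      (Q.mono (by omega) (by omega))
    omega
  have gp : 1 ≤ Nat.gcd p q := Nat.gcd_pos_of_pos_left _ hp
  have gle : Nat.gcd p q ≤ p := Nat.gcd_le_left _ hp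
  have P' := per_extend P G hp (Nat.gcd_dvd_left p q) (by omega) (by omega) (by omega)
  have Q' := per_extend Q G hq (Nat.gcd_dvd_right p q) (by omega) (by omega) (by omega)
  have e : Nat.gcd p q = p := by
    by_contra hne
    exact hmin _ gp (by omega) i (by omega) (P'.mono le_rfl (by omega))
  rw [e] at Q'
  exact ⟨e ▸ Nat.gcd_dvd_right p q, Q'⟩

lemma MinP.unique {k w : ℕ} {x : ℕ → ℕ} {p q : ℕ} (h : MinP k w x p) (h' : MinP k w x q) :
    p = q := by
  obtain ⟨hp, ⟨i, hi, P⟩, hmin⟩ := h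
  obtain ⟨hq, ⟨j, hj, Q⟩, hmin'⟩ := h'
  rcases lt_trichotomy p q with h | h | h
  · exact absurd P (hmin' p hp h i hi)
  · exact h
  · exact absurd Q (hmin q hq h j hj)

lemma MinP.exists {k w : ℕ} {x : ℕ → ℕ} {p i : ℕ} (hp : 1 ≤ p) (hi : i + p ≤ w)
    (P : Per x i (i + p + k) p) : ∃ q, MinP k w x q := by
  classical
  have H : ∃ p, 1 ≤ p ∧ ∃ i, i + p ≤ w ∧ Per x i (i + p + k) p := ⟨p, hp, i, hi, P⟩
  refine ⟨Nat.find H, (Nat.find_spec H).1, (Nat.find_spec H).2, ?_⟩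
  intro q hq hlt j hj Q
  exact Nat.find_min H hlt ⟨hq, j, hj, Q⟩

def TT (k w : ℕ) (x : ℕ → ℕ) (p a r : ℕ) : Prop := MinP k w x p ∧ Per x a (w + k - r) p

def NN (k w : ℕ) (x : ℕ → ℕ) (p a r : ℕ) : Prop :=
  TT k w x p a r ∧ (1 ≤ a → ¬ TT k w x p (a - 1) r) ∧ (1 ≤ r → ¬ TT k w x p a (r - 1))

lemma TT.mono {k w : ℕ} {x : ℕ → ℕ} {p a r a' r' : ℕ} (h : TT k w x p a r) (ha : a ≤ a')
    (hr : r ≤ r') : TT k w x p a' r' := ⟨h.1, h.2.mono ha (by omega)⟩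

lemma TT.inter {k w : ℕ} {x : ℕ → ℕ} {p a r a' r' : ℕ} (hwk : w ≤ k) (h : TT k w x p a r)
    (h' : TT k w x p a' r') (h1 : p + a + r ≤ w) (h2 : p + a' + r' ≤ w) :
    TT k w x p (min a a') (min r r') := by
  refine ⟨h.1, fun i hi hj => ?_⟩
  by_cases c1 : a ≤ i ∧ i + p < w + k - r
  · exact h.2 i c1.1 c1.2
  · by_cases c2 : a' ≤ i ∧ i + p < w + k - r'
    · exact h'.2 i c2.1 c2.2
    · exfalso; omega

lemma NN.le {k w : ℕ} {x : ℕ → ℕ} {p a r a' r' : ℕ} (hwk : w ≤ k) (h : NN k w x p a r)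
    (h' : TT k w x p a' r') (h1 : p + a + r ≤ w) (h2 : p + a' + r' ≤ w) : a ≤ a' ∧ r ≤ r' := by
  have I := h.1.inter hwk h' h1 h2
  constructor
  · by_contra hc
    exact h.2.1 (by omega) (I.mono (by omega) (by omega))
  · by_contra hc
    exact h.2.2 (by omega) (I.mono (by omega) (by omega))

lemma NN.exists {k w : ℕ} {x : ℕ → ℕ} {p : ℕ} (h : MinP k w x p) :
    ∃ a r, p + a + r ≤ w ∧ NN k w x p a r := by
  classical
  have h0 := h
  obtain ⟨hp, ⟨i, hi, P⟩, hmin⟩ := h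
  have H : ∃ a, ∃ r, p + a + r ≤ w ∧ TT k w x p a r := by
    refine ⟨i, w - p - i, by omega, h0, ?_⟩
    rwa [show w + k - (w - p - i) = i + p + k by omega]
  have H2 := Nat.find_spec H
  have a1 := fun m => Nat.find_min H (m := m)
  generalize Nat.find H = a at H2 a1
  have H3 := Nat.find_spec H2
  have a2 := fun m => Nat.find_min H2 (m := m)
  generalize Nat.find H2 = r at H3 a2
  refine ⟨a, r, H3.1, H3.2, ?_, ?_⟩
  · intro ha hT
    exact a1 (a - 1) (by omega) ⟨r, by omega, hT⟩
  · intro ha hT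
    exact a2 (r - 1) (by omega) ⟨by omega, hT⟩

/-- The positions whose kmer repeats at distance `p`. -/
lemma NN.mem_iff {k w : ℕ} {x : ℕ → ℕ} {p a r i : ℕ} (hwk : w ≤ k) (h : NN k w x p a r)
    (h1 : p + a + r ≤ w) (hi : i + p ≤ w) :
    Per x i (i + p + k) p ↔ a ≤ i ∧ i + p + r ≤ w := by
  constructor
  · intro P
    have := h.le hwk (a' := i) (r' := w - p - i) ⟨h.1.1, by
      rwa [show w + k - (w - p - i) = i + p + k by omega]⟩ h1 (by omega)
    omega
  · rintro ⟨h2, h3⟩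
    exact h.1.2.mono h2 (by omega)

def ext9 (σ n : ℕ) (v : Fin n → Fin σ) (i : ℕ) : ℕ := if h : i < n then (v ⟨i, h⟩).1 else 0

lemma ext9_lt {σ n : ℕ} (v : Fin n → Fin σ) {i : ℕ} (h : i < n) : ext9 σ n v i = (v ⟨i, h⟩).1 := by
  simp [ext9, h]

lemma kmer_eq_iff {σ k w : ℕ} (v : Fin (w + k) → Fin σ) (i j : Fin (w + 1)) (q : ℕ)
    (hq : i.1 + q = j.1) :
    kmerAt σ k w v i = kmerAt σ k w v j ↔ Per (ext9 σ (w + k) v) i.1 (i.1 + q + k) q := by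
  have hj := j.2
  constructor
  · intro h l hl hl'
    rw [ext9_lt v (by omega), ext9_lt v (by omega)]
    have := congrFun h ⟨l - i.1, by omega⟩
    simp only [kmerAt] at this
    have e1 : (⟨i.1 + (l - i.1), by omega⟩ : Fin (w + k)) = ⟨l, by omega⟩ := by
      ext; simp; omega
    have e2 : (⟨j.1 + (l - i.1), by omega⟩ : Fin (w + k)) = ⟨l + q, by omega⟩ := by
      ext; simp; omega
    rw [e1, e2] at this
    rw [this]
  · intro h
    funext l
    have hl := l.2
    have := h (i.1 + l.1) (by omega) (by omega)
    rw [ext9_lt v (by omega), ext9_lt v (by omega)] at this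
    simp only [kmerAt]
    apply Fin.ext
    rw [this]
    congr 2
    ext; simp; omega

lemma mem_RepSet_iff {σ k w : ℕ} (v : Fin (w + k) → Fin σ) :
    v ∈ RepSet σ k w ↔ ∃ p, MinP k w (ext9 σ (w + k) v) p := by
  simp only [RepSet, mem_filter, mem_univ, true_and]
  constructor
  · rintro ⟨i, j, hij, h⟩
    wlog hlt : i < j generalizing i j
    · exact this j i hij.symm h.symm (lt_of_le_of_ne (not_lt.1 hlt) hij.symm)
    have hlt' : i.1 < j.1 := hlt
    have hj := j.2
    exact MinP.exists (p := j.1 - i.1) (i := i.1) (by omega) (by omega)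
      ((kmer_eq_iff v i j (j.1 - i.1) (by omega)).1 h)
  · rintro ⟨p, hp, ⟨i, hi, P⟩, -⟩
    refine ⟨⟨i, by omega⟩, ⟨i + p, by omega⟩, ?_, ?_⟩
    · intro h
      have := congrArg Fin.val h
      simp at this; omega
    · exact (kmer_eq_iff v _ _ p rfl).2 P

/-- numbers of distinct kmers -/
lemma card_kmers {σ k w : ℕ} (hwk : w ≤ k) (v : Fin (w + k) → Fin σ) {p a r : ℕ}
    (h : NN k w (ext9 σ (w + k) v) p a r) (h1 : p + a + r ≤ w) :
    numKmers σ k w v = p + a + r := by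
  have hp : 1 ≤ p := h.1.1.1
  set D : Finset (Fin (w + 1)) := univ.filter (fun i => i.1 < a ∨ w < i.1 + p + r) with hD
  have himg : univ.image (kmerAt σ k w v) = D.image (kmerAt σ k w v) := by
    apply Finset.Subset.antisymm
    · intro u hu
      simp only [mem_image, mem_univ, true_and] at hu
      obtain ⟨i, rfl⟩ := hu
      have : ∀ N : ℕ, ∀ i : Fin (w + 1), w - i.1 ≤ N →
          kmerAt σ k w v i ∈ D.image (kmerAt σ k w v) := by
        intro N
        induction N with
        | zero =>
          intro i hi
          have := i.2
          apply mem_image_of_mem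
          simp [hD]; right; omega
        | succ N ih =>
          intro i hi
          by_cases hc : i.1 < a ∨ w < i.1 + p + r
          · apply mem_image_of_mem
            simpa [hD] using hc
          · have P := (h.mem_iff hwk h1 (i := i.1) (by omega)).2 (by omega)
            have := (kmer_eq_iff v i ⟨i.1 + p, by omega⟩ p rfl).2 P
            rw [this]
            apply ih
            simp; omega
      exact this _ i le_rfl
    · exact image_subset_image (subset_univ _)
  have hinj : Set.InjOn (kmerAt σ k w v) D := by
    intro i hi j hj hij
    by_contra hne
    wlog hlt : i < j generalizing i j
    · exact this hj hi hij.symm (Ne.symm hne) (lt_of_le_of_ne (not_lt.1 hlt) (Ne.symm hne))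
    have hlt' : i.1 < j.1 := hlt
    have hj2 := j.2
    have Q := (kmer_eq_iff v i j (j.1 - i.1) (by omega)).1 hij
    obtain ⟨hd, Q'⟩ := h.1.1.key hwk (q := j.1 - i.1) (by omega) (by omega) Q
    have hle := Nat.le_of_dvd (by omega) hd
    have := (h.mem_iff hwk h1 (i := i.1) (by omega)).1 (Q'.mono le_rfl (by omega))
    simp [hD] at hi
    omega
  rw [numKmers, himg, card_image_of_injOn hinj]
  have hc : D.card = ((range (w + 1)) \ (Ico a (w + 1 - p - r))).card := by
    apply card_bij (fun i _ => i.1)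
    · intro i hi
      have := i.2
      simp [hD] at hi ⊢
      omega
    · intro i _ j _ hij; exact Fin.ext hij
    · intro b hb
      simp at hb
      refine ⟨⟨b, by omega⟩, ?_, rfl⟩
      simp [hD]
      omega
  rw [hc, card_sdiff_of_subset]
  · simp; omega
  · intro i hi; simp at hi ⊢; omega

lemma suffix_unique_iff {σ k w : ℕ} (hwk : w ≤ k) (v : Fin (w + k) → Fin σ) {p a r : ℕ}
    (h : NN k w (ext9 σ (w + k) v) p a r) (h1 : p + a + r ≤ w) :
    (∀ i : Fin (w + 1), kmerAt σ k w v i = kmerAt σ k w v (Fin.last w) → i = Fin.last w) ↔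
      1 ≤ r := by
  have hp : 1 ≤ p := h.1.1.1
  constructor
  · intro H
    by_contra hr
    have P := (h.mem_iff hwk h1 (i := w - p) (by omega)).2 (by omega)
    have := H ⟨w - p, by omega⟩ ((kmer_eq_iff v _ _ p (by simp; omega)).2 P)
    have := congrArg Fin.val this
    simp at this
    omega
  · intro hr i hi
    by_contra hne
    have hlt : i.1 < w := by
      have := i.2
      have : i.1 ≠ w := fun h => hne (Fin.ext h)
      omega
    have Q := (kmer_eq_iff v i (Fin.last w) (w - i.1) (by simp; omega)).1 hi
    obtain ⟨hd, Q'⟩ := h.1.1.key hwk (q := w - i.1) (by omega) (by omega) Q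
    have hle := Nat.le_of_dvd (by omega) hd
    have := (h.mem_iff hwk h1 (i := w - p) (by omega)).1 (Q'.mono (by omega) (by omega))
    omega

section orders
variable {α β : Type*} [Fintype α] [DecidableEq α] [Fintype β] [LinearOrder β]

lemma card_min_eq (K : Finset α) (u u' : α) (hu : u ∈ K) (hu' : u' ∈ K) :
    (univ.filter (fun ρ : α ≃ β => ∀ y ∈ K, ρ u ≤ ρ y)).card =
    (univ.filter (fun ρ : α ≃ β => ∀ y ∈ K, ρ u' ≤ ρ y)).card := by
  have hK : ∀ y ∈ K, Equiv.swap u u' y ∈ K := by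
    intro y hy
    by_cases h1 : y = u
    · subst h1; simpa using hu'
    by_cases h2 : y = u'
    · subst h2; simpa using hu
    rwa [Equiv.swap_apply_of_ne_of_ne h1 h2]
  apply card_bij' (fun ρ _ => (Equiv.swap u u').trans ρ) (fun ρ _ => (Equiv.swap u u').trans ρ)
  · intro ρ hρ
    simp only [mem_filter, mem_univ, true_and] at hρ ⊢
    intro y hy
    simpa using hρ _ (hK y hy)
  · intro ρ hρ
    simp only [mem_filter, mem_univ, true_and] at hρ ⊢
    intro y hy
    simpa using hρ _ (hK y hy)
  · intro ρ _; ext y; simp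
  · intro ρ _; ext y; simp

lemma card_min_mul (K : Finset α) (u : α) (hu : u ∈ K) :
    K.card * (univ.filter (fun ρ : α ≃ β => ∀ y ∈ K, ρ u ≤ ρ y)).card = Fintype.card (α ≃ β) := by
  have h1 : (univ : Finset (α ≃ β)) =
      K.biUnion (fun u => univ.filter (fun ρ : α ≃ β => ∀ y ∈ K, ρ u ≤ ρ y)) := by
    ext ρ
    simp only [mem_univ, mem_biUnion, mem_filter, true_and, true_iff]
    exact K.exists_min_image ρ ⟨u, hu⟩
  have h2 : Fintype.card (α ≃ β) = (K.biUnion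
      (fun u => univ.filter (fun ρ : α ≃ β => ∀ y ∈ K, ρ u ≤ ρ y))).card := by
    rw [← h1, Finset.card_univ]
  rw [h2, card_biUnion]
  · rw [sum_congr rfl (fun u' hu' => card_min_eq K u' u hu' hu)]
    simp
  · intro a ha b hb hab
    rw [Function.onFun, Finset.disjoint_left]
    intro ρ h1 h2
    simp only [mem_filter, mem_univ, true_and] at h1 h2
    exact hab (ρ.injective (le_antisymm (h1 b hb) (h2 a ha)))

end orders

lemma Pgc_eq {σ k w : ℕ} (hw : 1 ≤ w) (v : Fin (w + k) → Fin σ) (b : Prop) [Decidable b]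
    (hb : (∀ i : Fin (w + 1), kmerAt σ k w v i = kmerAt σ k w v (Fin.last w) → i = Fin.last w) ↔ b) :
    Pgc σ k w v = (1 + if b then 1 else 0) / (numKmers σ k w v : ℝ) := by
  classical
  set K := univ.image (kmerAt σ k w v) with hK
  have hmem : ∀ i, kmerAt σ k w v i ∈ K := fun i => mem_image_of_mem _ (mem_univ _)
  have hall : ∀ (ρ : (Fin k → Fin σ) ≃ Fin (σ ^ k)) u,
      (∀ y ∈ K, ρ u ≤ ρ y) ↔ ∀ i, ρ u ≤ ρ (kmerAt σ k w v i) := by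
    intro ρ u; simp [hK]
  have c0 := card_min_mul (β := Fin (σ ^ k)) K _ (hmem 0)
  have c1 := card_min_mul (β := Fin (σ ^ k)) K _ (hmem (Fin.last w))
  have hT : 0 < Fintype.card ((Fin k → Fin σ) ≃ Fin (σ ^ k)) := by
    rw [Fintype.card_pos_iff]
    exact ⟨Fintype.equivFinOfCardEq (by simp)⟩
  have hKpos : 0 < K.card := by
    rw [card_pos]; exact ⟨_, hmem 0⟩
  have hn : numKmers σ k w v = K.card := rfl
  rw [hn, Pgc, Nat.card_eq_fintype_card, Nat.card_eq_fintype_card, Fintype.card_subtype]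
  rw [div_eq_div_iff (by positivity) (by positivity)]
  by_cases hbb : b
  · have hu := hb.2 hbb
    have hdis : (univ.filter (fun ρ => IsGC σ k w ρ v)).card =
        (univ.filter (fun ρ : (Fin k → Fin σ) ≃ Fin (σ ^ k) =>
          ∀ y ∈ K, ρ (kmerAt σ k w v 0) ≤ ρ y)).card +
        (univ.filter (fun ρ : (Fin k → Fin σ) ≃ Fin (σ ^ k) =>
          ∀ y ∈ K, ρ (kmerAt σ k w v (Fin.last w)) ≤ ρ y)).card := by
      rw [← card_union_of_disjoint]
      · congr 1
        ext ρ
        simp only [mem_filter, mem_univ, true_and, mem_union, hall]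
        unfold IsGC
        tauto
      · rw [Finset.disjoint_left]
        intro ρ h1 h2
        simp only [mem_filter, mem_univ, true_and] at h1 h2
        have := hu 0 (ρ.injective (le_antisymm (h1 _ (hmem _)) (h2 _ (hmem _))))
        have := congrArg Fin.val this
        simp at this
        omega
    rw [hdis, if_pos hbb]
    have d0 := congrArg (Nat.cast (R := ℝ)) c0
    have d1 := congrArg (Nat.cast (R := ℝ)) c1
    push_cast at d0 d1 ⊢
    linarith
  · have hu : ¬ _ := fun h => hbb (hb.1 h)
    have hdis : (univ.filter (fun ρ => IsGC σ k w ρ v)).card =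
        (univ.filter (fun ρ : (Fin k → Fin σ) ≃ Fin (σ ^ k) =>
          ∀ y ∈ K, ρ (kmerAt σ k w v 0) ≤ ρ y)).card := by
      congr 1
      ext ρ
      simp only [mem_filter, mem_univ, true_and, hall]
      unfold IsGC
      tauto
    rw [hdis, if_neg hbb]
    have d0 := congrArg (Nat.cast (R := ℝ)) c0
    push_cast at d0 ⊢
    linarith

lemma Pgc_NN {σ k w : ℕ} (hw : 1 ≤ w) (hwk : w ≤ k) (v : Fin (w + k) → Fin σ) {p a r : ℕ}
    (h : NN k w (ext9 σ (w + k) v) p a r) (h1 : p + a + r ≤ w) :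
    Pgc σ k w v = (1 + if 1 ≤ r then 1 else 0) / ((p + a + r : ℕ) : ℝ) := by
  rw [Pgc_eq hw v (1 ≤ r) (suffix_unique_iff hwk v h h1), card_kmers hwk v h h1]

lemma Pgc_not_Rep {σ k w : ℕ} (hw : 1 ≤ w) (v : Fin (w + k) → Fin σ) (h : v ∉ RepSet σ k w) :
    Pgc σ k w v = 2 / ((w : ℝ) + 1) := by
  have hinj : Function.Injective (kmerAt σ k w v) := by
    intro i j hij
    by_contra hne
    exact h (by simp only [RepSet, mem_filter, mem_univ, true_and]; exact ⟨i, j, hne, hij⟩)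
  rw [Pgc_eq hw v True (by simpa using fun i hi => hinj hi), numKmers,
    card_image_of_injective _ hinj]
  simp
  norm_num

lemma DR_eq {σ k w : ℕ} :
    DR σ k w = (∑ v, Pgc σ k w v) / (σ : ℝ) ^ (w + k) := by
  classical
  simp only [DR, Dens, Pgc]
  rw [← Finset.sum_div, ← Finset.sum_div, div_right_comm]
  congr 2
  rw [← Nat.cast_sum, ← Nat.cast_sum]
  congr 1
  simp only [Nat.card_eq_fintype_card, Fintype.card_subtype, card_filter]
  rw [sum_comm]

lemma part1 {σ k w : ℕ} (hσ : 2 ≤ σ) (hw : 1 ≤ w) :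
    DR σ k w = 2 / ((w : ℝ) + 1) + Dev σ k w / (σ : ℝ) ^ (w + k) := by
  have hs : (0 : ℝ) < (σ : ℝ) ^ (w + k) := by positivity
  rw [DR_eq, ← Finset.sum_add_sum_compl (RepSet σ k w)]
  rw [sum_congr (s₁ := (RepSet σ k w)ᶜ) rfl
    (fun v hv => Pgc_not_Rep hw v (by simpa using hv)), sum_const, card_compl,
    nsmul_eq_mul, Nat.cast_sub (card_le_univ _), Dev]
  simp
  field_simp
  ring

lemma hasPeriod_iff {σ n : ℕ} (v : Fin n → Fin σ) {a p d : ℕ} (h : a + p ≤ n) :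
    HasPeriod σ p (subAt σ n v a p h) d ↔ Per (ext9 σ n v) a (a + p) d := by
  constructor
  · intro H i hi hj
    have := H (i - a) (by omega)
    simp only [subAt] at this
    rw [ext9_lt v (by omega), ext9_lt v (by omega)]
    have e1 : (⟨a + (i - a), by omega⟩ : Fin n) = ⟨i, by omega⟩ := by ext; simp; omega
    have e2 : (⟨a + (i - a + d), by omega⟩ : Fin n) = ⟨i + d, by omega⟩ := by ext; simp; omega
    rw [e1, e2] at this
    rw [this]
  · intro H i hi
    have := H (a + i) (by omega) (by omega)
    rw [ext9_lt v (by omega), ext9_lt v (by omega)] at this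
    simp only [subAt]
    apply Fin.ext
    rw [this]
    congr 2
    ext; simp; omega

lemma TT_iff {σ k w : ℕ} (hwk : w ≤ k) (v : Fin (w + k) → Fin σ) {p a r : ℕ} (hp : 1 ≤ p)
    (h1 : p + a + r ≤ w) (h2 : a + p ≤ w + k) :
    TT k w (ext9 σ (w + k) v) p a r ↔ Per (ext9 σ (w + k) v) a (w + k - r) p ∧
      IsPrimitive σ p (subAt σ (w + k) v a p h2) := by
  constructor
  · rintro ⟨hm, P⟩
    refine ⟨P, ?_⟩
    rintro ⟨d, hd, hlt, H⟩
    rw [hasPeriod_iff] at H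
    have hdp : 1 ≤ d := Nat.pos_of_dvd_of_pos hd hp
    have := per_extend P H hp hd le_rfl (by omega) le_rfl
    exact hm.2.2 d hdp hlt a (by omega) (this.mono le_rfl (by omega))
  · rintro ⟨P, hprim⟩
    refine ⟨?_, P⟩
    have P' := P.mono (c := a) (d := a + p + k) le_rfl (by omega)
    obtain ⟨q, hq⟩ := MinP.exists hp (by omega : a + p ≤ w) P'
    obtain ⟨hd, Q⟩ := hq.key hwk hp (by omega) P'
    rcases (Nat.le_of_dvd hp hd).eq_or_lt with e | hlt
    · rwa [← e]
    · exact absurd ⟨q, hd, hlt, (hasPeriod_iff v h2).2 (Q.mono le_rfl (by omega))⟩ hprim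

/-- glue a word from a root and the outside letters -/
def glue (σ n p a r : ℕ) (hp : 1 ≤ p) (s : Fin p → Fin σ) (l : Fin a → Fin σ) (t : Fin r → Fin σ) :
    Fin n → Fin σ := fun i =>
  if h : i.1 < a then l ⟨i.1, h⟩
  else if h' : i.1 < n - r then s ⟨(i.1 - a) % p, Nat.mod_lt _ hp⟩
  else t ⟨i.1 - (n - r), by have := i.2; omega⟩

lemma ext9_glue {σ n p a r : ℕ} (hp : 1 ≤ p) (s : Fin p → Fin σ) (l : Fin a → Fin σ)
    (t : Fin r → Fin σ) {i : ℕ} (hi : a ≤ i) (hi' : i < n - r) :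
    ext9 σ n (glue σ n p a r hp s l t) i = (s ⟨(i - a) % p, Nat.mod_lt _ hp⟩).1 := by
  rw [ext9_lt _ (by omega)]
  simp [glue, hi', not_lt.2 hi]

lemma card_per {σ n p a r : ℕ} (hp : 1 ≤ p) (h : p + a + r ≤ n) (h2 : a + p ≤ n) :
    Nat.card {v : Fin n → Fin σ // Per (ext9 σ n v) a (n - r) p ∧
      IsPrimitive σ p (subAt σ n v a p h2)} = Prim σ p * σ ^ (a + r) := by
  have E : {v : Fin n → Fin σ // Per (ext9 σ n v) a (n - r) p ∧
      IsPrimitive σ p (subAt σ n v a p h2)} ≃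
      {s : Fin p → Fin σ // IsPrimitive σ p s} × ((Fin a → Fin σ) × (Fin r → Fin σ)) := by
    have hsub : ∀ (s : Fin p → Fin σ) l t, subAt σ n (glue σ n p a r hp s l t) a p h2 = s := by
      intro s l t
      funext j
      have hj := j.2
      simp only [subAt, glue]
      rw [dif_neg (by omega), dif_pos (by omega)]
      congr 1
      ext
      simp [Nat.mod_eq_of_lt hj]
    refine
      { toFun := fun v => (⟨subAt σ n v.1 a p h2, v.2.2⟩,
          (fun i => v.1 ⟨i.1, by have := i.2; omega⟩),
          (fun i => v.1 ⟨n - r + i.1, by have := i.2; omega⟩))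
        invFun := fun z => ⟨glue σ n p a r hp z.1.1 z.2.1 z.2.2, ?_, ?_⟩
        left_inv := ?_
        right_inv := ?_ }
    · intro i hi hj
      rw [ext9_glue hp _ _ _ hi (by omega), ext9_glue hp _ _ _ (by omega) hj]
      have e : (i - a) % p = (i + p - a) % p := by
        rw [show i + p - a = i - a + p by omega, Nat.add_mod_right]
      simp only [e]
    · rw [hsub]; exact z.1.2
    · rintro ⟨v, P, hv⟩
      apply Subtype.ext
      funext i
      have hi := i.2
      simp only [glue]
      split_ifs with c1 c2
      · rfl
      · simp only [subAt]
        have hm := Nat.mod_lt (i.1 - a) hp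
        have := P.modEq (i := a + (i.1 - a) % p) (j := i.1) (by omega) (by omega) (by omega) c2 (by
          have e := (Nat.mod_modEq (i.1 - a) p).add_left a
          rwa [show a + (i.1 - a) = i.1 by omega] at e)
        rw [ext9_lt _ (by omega), ext9_lt _ hi] at this
        exact Fin.ext this
      · congr 1
        ext; simp; omega
    · rintro ⟨⟨s, hs⟩, l, t⟩
      refine Prod.ext (Subtype.ext (hsub s l t)) (Prod.ext ?_ ?_)
      · funext i
        have := i.2
        simp [glue]
      · funext i
        have := i.2
        simp only [glue]
        rw [dif_neg (by omega), dif_neg (by omega)]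
        congr 1
        ext; simp
  rw [Nat.card_congr E, Nat.card_prod, Nat.card_prod, Prim, pow_add]
  simp

open Classical in
noncomputable def TS (σ k w p a r : ℕ) : Finset (Fin (w + k) → Fin σ) :=
  univ.filter (fun v => TT k w (ext9 σ (w + k) v) p a r)

open Classical in
noncomputable def NS (σ k w p a r : ℕ) : Finset (Fin (w + k) → Fin σ) :=
  univ.filter (fun v => NN k w (ext9 σ (w + k) v) p a r)

lemma card_TS {σ k w p a r : ℕ} (hwk : w ≤ k) (hp : 1 ≤ p) (h1 : p + a + r ≤ w) :
    ((TS σ k w p a r).card : ℝ) = Prim σ p * (σ : ℝ) ^ a * (σ : ℝ) ^ r := by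
  have := card_per (σ := σ) (n := w + k) (a := a) (r := r) hp (by omega) (by omega)
  have e : (TS σ k w p a r).card = Prim σ p * σ ^ (a + r) := by
    classical
    rw [← this, TS, ← Fintype.card_subtype, ← Nat.card_eq_fintype_card]
    exact Nat.card_congr (Equiv.subtypeEquivRight (fun v => TT_iff hwk v hp h1 (by omega)))
  rw [e, pow_add]
  push_cast
  ring

def cc (σ a : ℕ) : ℝ := if 1 ≤ a then (σ : ℝ) ^ a - (σ : ℝ) ^ (a - 1) else 1

open Classical in
noncomputable def LS (σ k w p a r : ℕ) : Finset (Fin (w + k) → Fin σ) :=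
  if 1 ≤ a then TS σ k w p a r \ TS σ k w p (a - 1) r else TS σ k w p a r

lemma card_LS {σ k w p a r : ℕ} (hwk : w ≤ k) (hp : 1 ≤ p) (h1 : p + a + r ≤ w) :
    ((LS σ k w p a r).card : ℝ) = Prim σ p * cc σ a * (σ : ℝ) ^ r := by
  unfold LS cc
  split_ifs with ha
  · have hsub : TS σ k w p (a - 1) r ⊆ TS σ k w p a r := by
      intro v hv
      simp only [TS, mem_filter, mem_univ, true_and] at hv ⊢
      exact hv.mono (by omega) le_rfl
    rw [card_sdiff_of_subset hsub, Nat.cast_sub (card_le_card hsub), card_TS hwk hp h1,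
      card_TS hwk hp (by omega)]
    ring
  · rw [card_TS hwk hp h1]
    simp [show a = 0 by omega]

lemma card_NS {σ k w p a r : ℕ} (hwk : w ≤ k) (hp : 1 ≤ p) (h1 : p + a + r ≤ w) :
    ((NS σ k w p a r).card : ℝ) = Prim σ p * cc σ a * cc σ r := by
  classical
  by_cases hr : 1 ≤ r
  · have hsub : LS σ k w p a (r - 1) ⊆ LS σ k w p a r := by
      intro v hv
      unfold LS at hv ⊢
      split_ifs at hv ⊢ with ha
      · simp only [TS, mem_sdiff, mem_filter, mem_univ, true_and] at hv ⊢
        refine ⟨hv.1.mono le_rfl (by omega), fun h => hv.2 ?_⟩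
        exact (hv.1.inter hwk h (by omega) (by omega)).mono (by omega) (by omega)
      · simp only [TS, mem_filter, mem_univ, true_and] at hv ⊢
        exact hv.mono le_rfl (by omega)
    have e : NS σ k w p a r = LS σ k w p a r \ LS σ k w p a (r - 1) := by
      ext v
      unfold LS
      split_ifs with ha
      · simp only [NS, TS, NN, mem_sdiff, mem_filter, mem_univ, true_and, ha, hr, true_imp_iff]
        constructor
        · rintro ⟨x1, x2, x3⟩
          exact ⟨⟨x1, x2⟩, fun h => x3 h.1⟩
        · rintro ⟨⟨x1, x2⟩, x3⟩
          refine ⟨x1, x2, fun h => x3 ⟨h, fun h' => x2 (h'.mono le_rfl (by omega))⟩⟩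
      · simp only [NS, TS, NN, mem_sdiff, mem_filter, mem_univ, true_and, ha, hr, true_imp_iff,
          false_imp_iff]
    rw [e, card_sdiff_of_subset hsub, Nat.cast_sub (card_le_card hsub), card_LS hwk hp h1,
      card_LS hwk hp (by omega)]
    simp only [cc, hr, if_true]
    ring
  · have e : NS σ k w p a r = LS σ k w p a r := by
      ext v
      unfold LS
      split_ifs with ha
      · simp only [NS, TS, NN, mem_sdiff, mem_filter, mem_univ, true_and, ha, hr, true_imp_iff,
          false_imp_iff, and_true]
      · simp only [NS, TS, NN, mem_filter, mem_univ, true_and, ha, hr, false_imp_iff, and_true]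
    rw [e, card_LS hwk hp h1]
    simp [cc, show r = 0 by omega]

/-- master decomposition -/
lemma sum_Rep {σ k w : ℕ} (hwk : w ≤ k) (g : (Fin (w + k) → Fin σ) → ℝ) (φ : ℕ → ℕ → ℝ)
    (hg : ∀ v p a r, p + a + r ≤ w → NN k w (ext9 σ (w + k) v) p a r → g v = φ (p + a + r) r) :
    ∑ v ∈ RepSet σ k w, g v = ∑ t ∈ Icc 1 w, ∑ p ∈ Icc 1 t, ∑ ar ∈ antidiagonal (t - p),
      Prim σ p * cc σ ar.1 * cc σ ar.2 * φ t ar.2 := by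
  classical
  let I : Finset (Σ _ : ℕ, Σ _ : ℕ, ℕ × ℕ) :=
    (Icc 1 w).sigma (fun t => (Icc 1 t).sigma (fun p => antidiagonal (t - p)))
  have hU : RepSet σ k w = I.biUnion (fun x => NS σ k w x.2.1 x.2.2.1 x.2.2.2) := by
    ext v
    rw [mem_RepSet_iff]
    simp only [mem_biUnion, NS, mem_filter, mem_univ, true_and]
    constructor
    · rintro ⟨p, hp⟩
      obtain ⟨a, r, h1, h2⟩ := NN.exists hp
      have := hp.1
      refine ⟨⟨p + a + r, p, (a, r)⟩, ?_, h2⟩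
      simp only [I, mem_sigma, mem_Icc, HasAntidiagonal.mem_antidiagonal]
      omega
    · rintro ⟨x, -, hx⟩
      exact ⟨_, hx.1.1⟩
  rw [hU, sum_biUnion]
  · rw [show I = (Icc 1 w).sigma (fun t => (Icc 1 t).sigma (fun p => antidiagonal (t - p))) from rfl,
      sum_sigma]
    refine sum_congr rfl (fun t ht => ?_)
    rw [sum_sigma]
    refine sum_congr rfl (fun p hp => ?_)
    refine sum_congr rfl (fun ar har => ?_)
    simp only [mem_Icc, HasAntidiagonal.mem_antidiagonal] at ht hp har
    have e : p + ar.1 + ar.2 = t := by omega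
    rw [← card_NS hwk hp.1 (by omega), ← nsmul_eq_mul, ← sum_const]
    refine sum_congr rfl (fun v hv => ?_)
    simp only [NS, mem_filter, mem_univ, true_and] at hv
    rw [hg v p ar.1 ar.2 (by omega) hv, e]
  · rintro ⟨t, p, a, r⟩ hx ⟨t', p', a', r'⟩ hy hne
    rw [Function.onFun, Finset.disjoint_left]
    intro v h1 h2
    simp only [I, coe_sigma, Set.mem_sigma_iff, mem_coe, mem_Icc, HasAntidiagonal.mem_antidiagonal] at hx hy
    simp only [NS, mem_filter, mem_univ, true_and] at h1 h2
    apply hne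
    obtain rfl : p = p' := h1.1.1.unique h2.1.1
    have l1 := h1.le hwk h2.1 (by omega) (by omega)
    have l2 := h2.le hwk h1.1 (by omega) (by omega)
    obtain rfl : a = a' := by omega
    obtain rfl : r = r' := by omega
    obtain rfl : t = t' := by omega
    rfl

lemma sum_anti {σ : ℕ} (hσ : 2 ≤ σ) (y z : ℝ) (s : ℕ) :
    ∑ ar ∈ antidiagonal s, cc σ ar.1 * cc σ ar.2 * (if 1 ≤ ar.2 then y else z) =
      if s = 0 then z else (σ : ℝ) ^ s * ((1 - 1 / σ) * (y + z) + (s - 1) * (1 - 1 / σ) ^ 2 * y) := by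
  have hs : (σ : ℝ) ≠ 0 := by positivity
  rcases s with _ | s
  · simp [cc]
  have hc : ∀ a, cc σ (a + 1) = (σ : ℝ) ^ (a + 1) * (1 - 1 / σ) := by
    intro a
    simp [cc, pow_succ]
    field_simp
  rw [Finset.Nat.sum_antidiagonal_succ]
  rcases s with _ | s
  · simp [hc]
    simp [cc]
    ring
  rw [Finset.Nat.sum_antidiagonal_succ']
  rw [sum_congr (g := fun _ => (σ : ℝ) ^ (s + 2) * (1 - 1 / σ) ^ 2 * y) rfl]
  · simp [hc]
    simp [cc]
    ring
  · intro ar har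
    simp only [HasAntidiagonal.mem_antidiagonal] at har
    simp only [hc]
    rw [if_pos (by omega), ← har]
    ring

lemma sum_tel {σ : ℕ} (hσ : 2 ≤ σ) (m : ℕ) :
    ∑ s ∈ range (m + 1), (∑ ar ∈ antidiagonal s, cc σ ar.1 * cc σ ar.2) =
      (σ : ℝ) ^ m * ((m : ℝ) + 1 - m / σ) := by
  have hs : (σ : ℝ) ≠ 0 := by positivity
  have h := fun s => sum_anti hσ 1 1 s
  simp only [ite_self, mul_one] at h
  simp only [h]
  induction m with
  | zero => simp
  | succ m ih =>
    rw [sum_range_succ, ih, if_neg (by omega)]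
    push_cast
    field_simp
    ring

theorem stmt9 (σ k w : ℕ) (hσ : 2 ≤ σ) (hw : 1 ≤ w) (hwk : w ≤ k) :
    DR σ k w = 2 / ((w : ℝ) + 1) + Dev σ k w / (σ : ℝ) ^ (w + k) ∧
    Dev σ k w =
      (∑ t ∈ Finset.Icc 1 w, (1 / (t : ℝ)) *
        ((Prim σ t : ℝ) + ∑ p ∈ Finset.Ico 1 t, (Prim σ p : ℝ) * (σ : ℝ) ^ (t - p) *
          (2 * (t : ℝ) - 2 * p + 1 - (4 * (t : ℝ) - 4 * p - 1) / σ +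
            (2 * (t : ℝ) - 2 * p - 2) / (σ : ℝ) ^ 2))) -
      (2 / ((w : ℝ) + 1)) *
        ∑ p ∈ Finset.Icc 1 w, (Prim σ p : ℝ) * (σ : ℝ) ^ (w - p) *
          ((w : ℝ) - p + 1 - ((w : ℝ) - p) / σ) := by
  refine ⟨part1 hσ hw, ?_⟩
  have hs : (σ : ℝ) ≠ 0 := by positivity
  have A := sum_Rep (σ := σ) hwk (Pgc σ k w) (fun t r => (1 / (t : ℝ)) * (if 1 ≤ r then 2 else 1))
    (by
      intro v p a r h1 h2
      rw [Pgc_NN hw hwk v h2 h1]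
      split_ifs <;> ring)
  have B := sum_Rep (σ := σ) hwk (fun _ => 1) (fun _ _ => 1) (by intros; rfl)
  rw [sum_const, nsmul_eq_mul, mul_one] at B
  rw [Dev, A, B]
  congr 1
  · refine sum_congr rfl (fun t ht => ?_)
    simp only [mem_Icc] at ht
    rw [← Finset.Ico_insert_right ht.1, sum_insert (by simp), mul_add, mul_sum]
    congr 1
    · simp [cc]; ring
    · refine sum_congr rfl (fun p hp => ?_)
      simp only [mem_Ico] at hp
      have := sum_anti hσ 2 1 (t - p)
      rw [if_neg (by omega)] at this
      rw [sum_congr (g := fun ar : ℕ × ℕ => (1 / (t : ℝ)) * (Prim σ p : ℝ) *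
        (cc σ ar.1 * cc σ ar.2 * (if 1 ≤ ar.2 then 2 else 1))) rfl (fun _ _ => by ring),
        ← mul_sum, this, Nat.cast_sub hp.2.le]
      field_simp
      ring
  · congr 1
    rw [sum_comm' (t' := Icc 1 w) (s' := fun p => Icc p w)
      (by intro x y; simp only [mem_Icc]; omega)]
    refine sum_congr rfl (fun p hp => ?_)
    simp only [mem_Icc] at hp
    have := sum_tel hσ (w - p)
    rw [Nat.cast_sub hp.2] at this
    rw [mul_assoc, ← this, mul_sum, range_eq_Ico]
    have e := Finset.sum_Ico_add' (fun t => ∑ ar ∈ antidiagonal (t - p),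
      (Prim σ p : ℝ) * cc σ ar.1 * cc σ ar.2 * 1) 0 (w - p + 1) p
    rw [show Icc p w = Ico (0 + p) (w - p + 1 + p) by ext; simp; omega, ← e]
    refine sum_congr rfl (fun s _ => ?_)
    rw [Nat.add_sub_cancel, mul_sum]
    refine sum_congr rfl (fun ar _ => by ring)
end

section
/- Let σ ≥ 2 and 1 ≤ w ≤ k. Then there exists a bijection φ from Rep_{σ,k,w} onto Rep_{σ,k+1,w} such that P_{σ,k}(v) = P_{σ,k+1}(φ(v)) for every v ∈ Rep_{σ,k,w}. -/
open Finset

namespace GC12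

/-- periodicity on an interval, congruence form -/
def Per {A : Type*} (f : ℕ → A) (a b p : ℕ) : Prop :=
  ∀ x y, a ≤ x → x < b → a ≤ y → y < b → x ≡ y [MOD p] → f x = f y

/-- step form -/
def Stp {A : Type*} (f : ℕ → A) (a b p : ℕ) : Prop :=
  ∀ x, a ≤ x → x + p < b → f x = f (x + p)

/-- equality of windows -/
def EqW {A : Type*} (k : ℕ) (f : ℕ → A) (i j : ℕ) : Prop := ∀ t < k, f (i + t) = f (j + t)

theorem Stp.per {A : Type*} {f : ℕ → A} {a b p : ℕ} (h : Stp f a b p) : Per f a b p := by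
  have key : ∀ m x, a ≤ x → x + p * m < b → f x = f (x + p * m) := by
    intro m
    induction m with
    | zero => intro x _ _; simp
    | succ m ih =>
      intro x hx hb
      rw [Nat.mul_succ] at hb
      rw [Nat.mul_succ, ih x hx (by omega), h _ (by omega) (by omega), Nat.add_assoc]
  have key2 : ∀ x y, x ≤ y → a ≤ x → y < b → x ≡ y [MOD p] → f x = f y := by
    intro x y hxy hx hy hm
    obtain ⟨m, hm⟩ := (Nat.modEq_iff_dvd' hxy).1 hm
    have : y = x + p * m := by omega
    subst this
    exact key m x hx hy
  intro x y h1 h2 h3 h4 hm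
  rcases le_total x y with h | h
  · exact key2 x y h h1 h4 hm
  · exact (key2 y x h h3 h2 hm.symm).symm

theorem Per.stp {A : Type*} {f : ℕ → A} {a b p : ℕ} (h : Per f a b p) : Stp f a b p := by
  intro x hx hb
  refine h _ _ hx (by omega) (by omega) hb ?_
  simp [Nat.ModEq]

theorem Per.mono {A : Type*} {f : ℕ → A} {a b p c d : ℕ} (h : Per f a b p) (h1 : a ≤ c)
    (h2 : d ≤ b) : Per f c d p := fun x y a1 a2 a3 a4 hm =>
  h x y (by omega) (by omega) (by omega) (by omega) hm

theorem EqW.stp {A : Type*} {f : ℕ → A} {k i p : ℕ} (h : EqW k f i (i + p)) :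
    Stp f i (i + p + k) p := by
  intro x hx hb
  have := h (x - i) (by omega)
  rw [show i + (x - i) = x by omega, show i + p + (x - i) = x + p by omega] at this
  exact this

theorem Stp.eqW {A : Type*} {f : ℕ → A} {k i p : ℕ} (h : Stp f i (i + p + k) p) :
    EqW k f i (i + p) := by
  intro t ht
  rw [h (i + t) (by omega) (by omega)]
  congr 1; omega

theorem fine_wilf {A : Type*} {f : ℕ → A} {a b : ℕ} : ∀ n p q : ℕ, p + q ≤ n → a + p + q ≤ b →
    Stp f a b p → Stp f a b q → Stp f a b (Nat.gcd p q) := by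
  intro n
  induction n with
  | zero =>
    intro p q h _ h1 _
    have : p = 0 := by omega
    have : q = 0 := by omega
    subst_vars
    simpa using h1
  | succ n ih =>
    have main : ∀ p q : ℕ, 0 < p → p ≤ q → p + q ≤ n + 1 → a + p + q ≤ b →
        Stp f a b p → Stp f a b q → Stp f a b (Nat.gcd p q) := by
      intro p q hp hpq hn hb h1 h2
      have h3 : Stp f a b (q - p) := by
        intro x hx hxb
        by_cases hc : a + p ≤ x
        · have e1 := h1 (x - p) (by omega) (by omega)
          have e2 := h2 (x - p) (by omega) (by omega)
          rw [show x - p + p = x by omega] at e1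
          rw [show x - p + q = x + (q - p) by omega] at e2
          rw [← e1, e2]
        · have e1 := h1 (x + (q - p)) (by omega) (by omega)
          have e2 := h2 x (by omega) (by omega)
          rw [show x + (q - p) + p = x + q by omega] at e1
          rw [e1, e2]
      have := ih p (q - p) (by omega) (by omega) h1 h3
      rwa [Nat.gcd_sub_self_right hpq] at this
    intro p q hn hb h1 h2
    rcases Nat.eq_zero_or_pos p with rfl | hp
    · simpa using h2
    rcases Nat.eq_zero_or_pos q with rfl | hq
    · simpa using h1
    rcases le_total p q with h | h
    · exact main p q hp h hn hb h1 h2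
    · rw [Nat.gcd_comm]
      exact main q p hq h (by omega) (by omega) h2 h1

theorem exists_rep (c q x : ℕ) (hq : 0 < q) : ∃ y, c ≤ y ∧ y < c + q ∧ x ≡ y [MOD q] := by
  refine ⟨c + (x + (q - 1) * c) % q, by omega, by have := Nat.mod_lt (x + (q - 1) * c) hq; omega, ?_⟩
  have h1 : c + (x + (q - 1) * c) % q ≡ c + (x + (q - 1) * c) [MOD q] :=
    Nat.ModEq.add_left _ (Nat.mod_modEq _ _)
  refine (h1.trans ?_).symm
  obtain ⟨r, rfl⟩ : ∃ r, q = r + 1 := ⟨q - 1, by omega⟩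
  rw [show c + (x + (r + 1 - 1) * c) = x + (r + 1) * c by simp; ring]
  simp [Nat.ModEq]

theorem Per.ext {A : Type*} {f : ℕ → A} {a b q c d g : ℕ} (hq : 0 < q) (h : Per f a b q)
    (h' : Per f c d g) (hg : g ∣ q) (h1 : a ≤ c) (h2 : d ≤ b) (h3 : c + q ≤ d) :
    Per f a b g := by
  intro x y hx hxb hy hyb hm
  obtain ⟨x', a1, a2, a3⟩ := exists_rep c q x hq
  obtain ⟨y', b1, b2, b3⟩ := exists_rep c q y hq
  rw [h x x' hx hxb (by omega) (by omega) a3, h y y' hy hyb (by omega) (by omega) b3]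
  exact h' _ _ a1 (by omega) b1 (by omega)
    (((a3.of_dvd hg).symm.trans hm).trans (b3.of_dvd hg))

theorem lemA {A : Type*} {f : ℕ → A} {k w i p j q : ℕ} (hwk : w ≤ k) (hp : 0 < p) (hq : 0 < q)
    (hi : i + p ≤ w) (hj : j + q ≤ w) (h1 : EqW k f i (i + p)) (h2 : EqW k f j (j + q)) :
    Per f i (i + p + k) (Nat.gcd p q) ∧ Per f j (j + q + k) (Nat.gcd p q) := by
  have s1 := h1.stp.per
  have s2 := h2.stp.per
  have := fine_wilf (f := f) (a := max i j) (b := min (i + p + k) (j + q + k)) _ p q le_rfl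
    (by omega) (s1.mono (by omega) (by omega)).stp (s2.mono (by omega) (by omega)).stp
  have := this.per
  exact ⟨s1.ext hp this (Nat.gcd_dvd_left _ _) (by omega) (by omega) (by omega),
    s2.ext hq this (Nat.gcd_dvd_right _ _) (by omega) (by omega) (by omega)⟩

/-- `p` is the minimal repeat distance -/
def MinRep {A : Type*} (k w p : ℕ) (f : ℕ → A) : Prop :=
  0 < p ∧ (∃ i, i + p ≤ w ∧ EqW k f i (i + p)) ∧
    ∀ q, 0 < q → q < p → ∀ i, i + q ≤ w → ¬ EqW k f i (i + q)

theorem MinRep.unique {A : Type*} {k w p q : ℕ} {f : ℕ → A} (h : MinRep k w p f)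
    (h' : MinRep k w q f) : p = q := by
  obtain ⟨a1, ⟨i, hi, e⟩, a3⟩ := h
  obtain ⟨b1, ⟨j, hj, e'⟩, b3⟩ := h'
  by_contra hne
  rcases Nat.lt_or_gt_of_ne hne with hlt | hlt
  · exact b3 p a1 hlt i hi e
  · exact a3 q b1 hlt j hj e'

theorem MinRep.exists {A : Type*} {k w i j : ℕ} {f : ℕ → A} (hij : i < j) (hj : j ≤ w)
    (h : EqW k f i j) : ∃ p, MinRep k w p f := by
  classical
  have hex : ∃ p, 0 < p ∧ ∃ i, i + p ≤ w ∧ EqW k f i (i + p) :=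
    ⟨j - i, by omega, i, by omega, by rwa [show i + (j - i) = j by omega]⟩
  refine ⟨Nat.find hex, (Nat.find_spec hex).1, (Nat.find_spec hex).2, ?_⟩
  intro q hq hlt i hi he
  exact Nat.find_min hex hlt ⟨hq, i, hi, he⟩

theorem lemB {A : Type*} {f : ℕ → A} {k w p i j : ℕ} (hwk : w ≤ k) (h : MinRep k w p f)
    (hij : i < j) (hj : j ≤ w) :
    EqW k f i j ↔ p ∣ j - i ∧ ∀ s, i ≤ s → s + p ≤ j → EqW k f s (s + p) := by
  obtain ⟨hp, ⟨i0, hi0, e0⟩, hmin⟩ := h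
  constructor
  · intro he
    obtain ⟨q, rfl⟩ : ∃ q, j = i + q := ⟨j - i, by omega⟩
    have hq : 0 < q := by omega
    obtain ⟨s1, s2⟩ := lemA hwk hp hq hi0 hj e0 he
    have hg0 : 0 < Nat.gcd p q := Nat.gcd_pos_of_pos_left _ hp
    have hgle : Nat.gcd p q ≤ p := Nat.gcd_le_left _ hp
    have hg : Nat.gcd p q = p := by
      by_contra hne
      refine hmin _ hg0 (by omega) i0 (by omega) ?_
      exact (s1.mono (d := i0 + Nat.gcd p q + k) le_rfl (by omega)).stp.eqW
    rw [hg] at s2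
    refine ⟨?_, ?_⟩
    · rw [show i + q - i = q by omega]
      exact hg ▸ Nat.gcd_dvd_right p q
    · intro s hs1 hs2
      exact (s2.mono (c := s) (d := s + p + k) hs1 (by omega)).stp.eqW
  · rintro ⟨hd, hs⟩
    have hst : Stp f i (j + k) p := by
      intro x hx hb
      by_cases hc : x + p ≤ j
      · simpa using hs x hx hc 0 (by omega)
      · have hdle := Nat.le_of_dvd (by omega) hd
        have := hs (j - p) (by omega) (by omega) (x - (j - p)) (by omega)
        rw [show j - p + (x - (j - p)) = x by omega,
          show j - p + p + (x - (j - p)) = x + p by omega] at this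
        exact this
    intro t ht
    refine hst.per _ _ (by omega) (by omega) (by omega) (by omega) ?_
    exact Nat.ModEq.add_right _ ((Nat.modEq_iff_dvd' hij.le).2 hd)

/-- the relation between `v` and its image -/
def Rl {A : Type*} [AddCommGroup A] (k w p : ℕ) (f g : ℕ → A) : Prop :=
  (∀ t < k, g t = f t) ∧ g k = g (k - p) ∧
    ∀ t, k ≤ t → t < w + k → g (t + 1) - g (t + 1 - p) = f t - f (t - p)

theorem Rl.adj {A : Type*} [AddCommGroup A] {k w p : ℕ} {f g : ℕ → A} (h : Rl k w p f g)
    (hwk : w ≤ k) {i : ℕ} (hi : i + p ≤ w) :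
    EqW k f i (i + p) ↔ EqW (k + 1) g i (i + p) := by
  obtain ⟨r1, r2, r3⟩ := h
  constructor
  · intro he
    have he := he.stp
    apply Stp.eqW
    intro x hx hb
    rcases lt_trichotomy (x + p) k with hc | hc | hc
    · rw [r1 _ hc, r1 x (by omega)]
      exact he x hx (by omega)
    · rw [hc, r2]; congr 1; omega
    · have e := r3 (x + p - 1) (by omega) (by omega)
      have e2 := he (x - 1) (by omega) (by omega)
      rw [show x + p - 1 + 1 = x + p by omega, show x + p - p = x by omega,
        show x + p - 1 - p = x - 1 by omega, e2, show x - 1 + p = x + p - 1 by omega, sub_self,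
        sub_eq_zero] at e
      exact e.symm
  · intro he
    have he := he.stp
    apply Stp.eqW
    intro x hx hb
    rcases lt_or_ge (x + p) k with hc | hc
    · rw [← r1 _ hc, ← r1 x (by omega)]
      exact he x hx (by omega)
    · have e := r3 (x + p) hc (by omega)
      have e2 := he (x + 1) (by omega) (by omega)
      rw [show x + p + 1 - p = x + 1 by omega, e2, show x + 1 + p = x + p + 1 by omega,
        sub_self, show x + p - p = x by omega] at e
      exact (sub_eq_zero.1 e.symm).symm

theorem transfer {A : Type*} {k k' w p i0 : ℕ} {f g : ℕ → A} (hwk : w ≤ k) (hwk' : w ≤ k')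
    (hfg : ∀ t < w, g t = f t) (h : MinRep k w p f) (hi0 : i0 + p ≤ w)
    (e0 : EqW k f i0 (i0 + p)) (e0' : EqW k' g i0 (i0 + p)) : MinRep k' w p g := by
  refine ⟨h.1, ⟨i0, hi0, e0'⟩, ?_⟩
  intro q hq hqp i hi he
  have hp := h.1
  obtain ⟨s1, -⟩ := lemA hwk' hp hq hi0 hi e0' he
  have hg0 : 0 < Nat.gcd p q := Nat.gcd_pos_of_pos_left _ hp
  have hgle : Nat.gcd p q ≤ q := Nat.gcd_le_right _ hq
  have s2 : Per f i0 (i0 + p) (Nat.gcd p q) := by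
    intro x y a1 a2 a3 a4 hm
    rw [← hfg x (by omega), ← hfg y (by omega)]
    exact s1 x y a1 (by omega) a3 (by omega) hm
  have s3 := e0.stp.per.ext hp s2 (Nat.gcd_dvd_left _ _) le_rfl (by omega) le_rfl
  exact h.2.2 _ hg0 (by omega) i0 (by omega)
    (s3.mono (d := i0 + Nat.gcd p q + k) le_rfl (by omega)).stp.eqW

theorem Rl.minRep {A : Type*} [AddCommGroup A] {k w p : ℕ} {f g : ℕ → A} (h : Rl k w p f g)
    (hwk : w ≤ k) : MinRep k w p f ↔ MinRep (k + 1) w p g := by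
  constructor
  · intro hm
    obtain ⟨i, hi, e⟩ := hm.2.1
    exact transfer hwk (by omega) (fun t ht => h.1 t (by omega)) hm hi e ((h.adj hwk hi).1 e)
  · intro hm
    obtain ⟨i, hi, e⟩ := hm.2.1
    exact transfer (by omega) hwk (fun t ht => (h.1 t (by omega)).symm) hm hi e
      ((h.adj hwk hi).2 e)

theorem Rl.pat {A : Type*} [AddCommGroup A] {k w p : ℕ} {f g : ℕ → A} (h : Rl k w p f g)
    (hwk : w ≤ k) (hm : MinRep k w p f) {i j : ℕ} (hi : i ≤ w) (hj : j ≤ w) :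
    EqW k f i j ↔ EqW (k + 1) g i j := by
  have key : ∀ i j, i < j → j ≤ w → (EqW k f i j ↔ EqW (k + 1) g i j) := by
    intro i j hij hj
    rw [lemB hwk hm hij hj, lemB (by omega) ((h.minRep hwk).1 hm) hij hj]
    refine and_congr_right fun _ => forall_congr' fun s => forall_congr' fun _ =>
      forall_congr' fun hs => h.adj hwk (by omega)
  rcases lt_trichotomy i j with hc | rfl | hc
  · exact key i j hc hj
  · exact ⟨fun _ _ _ => rfl, fun _ _ _ => rfl⟩
  · have := key j i hc hi
    exact ⟨fun a t ht => ((this.1 fun t ht => (a t ht).symm) t ht).symm,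
      fun a t ht => ((this.2 fun t ht => (a t ht).symm) t ht).symm⟩

theorem integ {A : Type*} [AddCommGroup A] (p : ℕ) (hp : 0 < p) (d : ℕ → A) :
    ∃ g : ℕ → A, (∀ t < p, g t = d t) ∧ ∀ t, p ≤ t → g t = g (t - p) + d t := by
  refine ⟨fun t => ∑ i ∈ Finset.range (t / p + 1), d (t % p + i * p), ?_, ?_⟩
  · intro t ht
    simp [Nat.div_eq_of_lt ht, Nat.mod_eq_of_lt ht]
  · intro t ht
    obtain ⟨s, rfl⟩ : ∃ s, t = s + p := ⟨t - p, by omega⟩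
    simp only [Nat.add_sub_cancel, Nat.add_div_right _ hp, Nat.add_mod_right]
    rw [Finset.sum_range_succ _ (s / p + 1)]
    congr 2
    have := Nat.mod_add_div s p
    rw [Nat.succ_mul, mul_comm]; omega

theorem Rl.exists_right {A : Type*} [AddCommGroup A] {k p : ℕ} (w : ℕ) (f : ℕ → A) (hp : 0 < p)
    (hpk : p ≤ k) : ∃ g, Rl k w p f g := by
  obtain ⟨g, g1, g2⟩ := integ p hp (fun t => if t < p then f t else if t < k then f t - f (t - p)
    else if t = k then 0 else f (t - 1) - f (t - 1 - p))
  refine ⟨g, ?_, ?_, ?_⟩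
  · intro t
    induction t using Nat.strong_induction_on with
    | _ t ih =>
      intro ht
      by_cases hc : t < p
      · simp [g1 t hc, hc]
      · rw [g2 t (by omega), ih (t - p) (by omega) (by omega)]
        simp [hc, ht]
  · rw [g2 k hpk]
    simp [Nat.not_lt.2 hpk]
  · intro t ht _
    rw [g2 (t + 1) (by omega)]
    rw [if_neg (by omega), if_neg (by omega), if_neg (by omega)]
    simp

theorem Rl.exists_left {A : Type*} [AddCommGroup A] {k p : ℕ} (w : ℕ) (g : ℕ → A) (hp : 0 < p)
    (hpk : p ≤ k) (hg : g k = g (k - p)) : ∃ f, Rl k w p f g := by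
  obtain ⟨f, f1, f2⟩ := integ p hp (fun t => if t < p then g t else if t < k then g t - g (t - p)
    else g (t + 1) - g (t + 1 - p))
  refine ⟨f, ?_, hg, ?_⟩
  · intro t
    induction t using Nat.strong_induction_on with
    | _ t ih =>
      intro ht
      by_cases hc : t < p
      · simp [f1 t hc, hc]
      · rw [f2 t (by omega), ← ih (t - p) (by omega) (by omega)]
        simp [hc, ht]
  · intro t ht _
    rw [f2 t (by omega)]
    rw [if_neg (by omega), if_neg (by omega)]
    simp

theorem Rl.congr {A : Type*} [AddCommGroup A] {k w p : ℕ} {f g f' g' : ℕ → A}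
    (h : Rl k w p f g) (hw : 0 < w) (hf : ∀ t < w + k, f' t = f t)
    (hg : ∀ t < w + k + 1, g' t = g t) : Rl k w p f' g' := by
  obtain ⟨r1, r2, r3⟩ := h
  refine ⟨fun t ht => ?_, ?_, fun t h1 h2 => ?_⟩
  · rw [hf t (by omega), hg t (by omega), r1 t ht]
  · rw [hg _ (by omega), hg _ (by omega), r2]
  · rw [hf t (by omega), hg (t + 1) (by omega), hf _ (by omega), hg _ (by omega), r3 t h1 h2]

theorem Rl.right_unique {A : Type*} [AddCommGroup A] {k w p : ℕ} {f g g' : ℕ → A}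
    (h : Rl k w p f g) (h' : Rl k w p f g') (hp : 0 < p) (hpk : p ≤ k) :
    ∀ t < w + k + 1, g t = g' t := by
  obtain ⟨r1, r2, r3⟩ := h
  obtain ⟨s1, s2, s3⟩ := h'
  intro t
  induction t using Nat.strong_induction_on with
  | _ t ih =>
    intro ht
    rcases lt_trichotomy t k with hc | rfl | hc
    · rw [r1 t hc, s1 t hc]
    · rw [r2, s2, ih _ (by omega) (by omega)]
    · have a := r3 (t - 1) (by omega) (by omega)
      have b := s3 (t - 1) (by omega) (by omega)
      rw [show t - 1 + 1 = t by omega] at a b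
      rw [← b, ih (t - p) (by omega) (by omega)] at a
      exact sub_left_injective a

theorem Rl.left_unique {A : Type*} [AddCommGroup A] {k w p : ℕ} {f f' g : ℕ → A}
    (h : Rl k w p f g) (h' : Rl k w p f' g) (hp : 0 < p) (hpk : p ≤ k) :
    ∀ t < w + k, f t = f' t := by
  obtain ⟨r1, r2, r3⟩ := h
  obtain ⟨s1, s2, s3⟩ := h'
  intro t
  induction t using Nat.strong_induction_on with
  | _ t ih =>
    intro ht
    rcases lt_or_ge t k with hc | hc
    · rw [← r1 t hc, ← s1 t hc]
    · have a := r3 t (by omega) (by omega)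
      have b := s3 t (by omega) (by omega)
      rw [b, ih (t - p) (by omega) (by omega)] at a
      exact (sub_left_injective a).symm

/-- extension by zero -/
def ex {n : ℕ} {A : Type*} [Zero A] (v : Fin n → A) (t : ℕ) : A := if h : t < n then v ⟨t, h⟩ else 0

theorem kmer_iff {σ k w : ℕ} [NeZero σ] (v : Fin (w + k) → Fin σ) (i j : Fin (w + 1)) :
    kmerAt σ k w v i = kmerAt σ k w v j ↔ EqW k (ex v) i j := by
  have hi := i.2
  have hj := j.2
  constructor
  · intro h t ht
    have := congrFun h ⟨t, ht⟩
    simp only [kmerAt] at this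
    rw [ex, ex, dif_pos (by omega), dif_pos (by omega), this]
  · intro h
    funext t
    have := h t t.2
    rw [ex, ex, dif_pos (by omega), dif_pos (by omega)] at this
    exact this

theorem rep_iff {σ k w : ℕ} [NeZero σ] (v : Fin (w + k) → Fin σ) :
    v ∈ RepSet σ k w ↔ ∃ p, MinRep k w p (ex v) := by
  simp only [RepSet, Finset.mem_filter, Finset.mem_univ, true_and]
  constructor
  · rintro ⟨i, j, hne, he⟩
    have hi := i.2
    have hj := j.2
    rcases lt_or_gt_of_ne hne with h | h
    · exact MinRep.exists (i := i) (j := j) h (by omega) ((kmer_iff v i j).1 he)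
    · exact MinRep.exists (i := j) (j := i) h (by omega) ((kmer_iff v j i).1 he.symm)
  · rintro ⟨p, hp, ⟨i, hi, e⟩, -⟩
    refine ⟨⟨i, by omega⟩, ⟨i + p, by omega⟩, ?_, (kmer_iff v _ _).2 e⟩
    simp [Fin.ext_iff]; omega

section prob
open Classical in
theorem card_min {X : Type*} [Fintype X] (N w : ℕ) (s : Fin (w + 1) → X) (i : Fin (w + 1)) :
    Nat.card {ρ : X ≃ Fin N // ∀ j, ρ (s i) ≤ ρ (s j)} * Nat.card (Set.range s) =
      Nat.card (X ≃ Fin N) := by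
  have hsw : ∀ x : Set.range s, Nat.card {ρ : X ≃ Fin N // ∀ j, ρ x ≤ ρ (s j)} =
      Nat.card {ρ : X ≃ Fin N // ∀ j, ρ (s i) ≤ ρ (s j)} := by
    rintro ⟨_, i', rfl⟩
    let S := Equiv.swap (s i) (s i')
    have hS : ∀ j, ∃ j', S (s j) = s j' := by
      intro j
      simp only [S, Equiv.swap_apply_def]
      split_ifs
      · exact ⟨_, rfl⟩
      · exact ⟨_, rfl⟩
      · exact ⟨_, rfl⟩
    refine Nat.card_congr (Equiv.subtypeEquiv
      ⟨fun ρ => S.trans ρ, fun ρ => S.trans ρ, fun ρ => ?_, fun ρ => ?_⟩ ?_)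
    · ext x; simp [S]
    · ext x; simp [S]
    · intro ρ
      have e1 : S (s i) = s i' := by simp [S]
      simp only [Equiv.coe_fn_mk, Equiv.trans_apply, e1]
      constructor
      · intro h j
        obtain ⟨j', hj'⟩ := hS j
        rw [hj']; exact h j'
      · intro h j
        obtain ⟨j', hj'⟩ := hS j
        have := h j'
        rw [← hj'] at this
        simpa [S] using this
  have hsig : Nat.card (Σ x : Set.range s, {ρ : X ≃ Fin N // ∀ j, ρ x ≤ ρ (s j)}) =
      Nat.card (X ≃ Fin N) := by
    refine Nat.card_congr (Equiv.ofBijective (fun y => y.2.1) ⟨?_, ?_⟩)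
    · rintro ⟨⟨_, i1, rfl⟩, ρ, h1⟩ ⟨⟨_, i2, rfl⟩, ρ', h2⟩ h
      dsimp only at h
      subst h
      have : s i1 = s i2 := ρ.injective (le_antisymm (h1 i2) (h2 i1))
      exact Sigma.subtype_ext (Subtype.ext this) rfl
    · intro ρ
      obtain ⟨i0, h0⟩ := Finite.exists_min (fun j => ρ (s j))
      exact ⟨⟨⟨s i0, i0, rfl⟩, ρ, h0⟩, rfl⟩
  rw [← hsig, Nat.card_sigma, Finset.sum_congr rfl (fun x _ => hsw x)]
  simp [mul_comm]

open Classical in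
theorem pgc_eq (σ k w : ℕ) (hw : 1 ≤ w) (v : Fin (w + k) → Fin σ) :
    Pgc σ k w v = (if ∀ i, kmerAt σ k w v i = kmerAt σ k w v (Fin.last w) → i = Fin.last w
      then 2 else 1) / (Nat.card (Set.range (kmerAt σ k w v)) : ℝ) := by
  set s := kmerAt σ k w v with hs
  have h0 := card_min (σ ^ k) w s 0
  have h1 := card_min (σ ^ k) w s (Fin.last w)
  have hT : (Nat.card ((Fin k → Fin σ) ≃ Fin (σ ^ k)) : ℝ) ≠ 0 := by
    have : Nonempty ((Fin k → Fin σ) ≃ Fin (σ ^ k)) := ⟨Fintype.equivOfCardEq (by simp)⟩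
    exact_mod_cast Nat.card_pos.ne'
  have hR : (Nat.card (Set.range s) : ℝ) ≠ 0 := by
    exact_mod_cast Nat.card_pos.ne'
  have h0' : ((Nat.card {ρ : (Fin k → Fin σ) ≃ Fin (σ ^ k) // ∀ j, ρ (s 0) ≤ ρ (s j)} : ℕ) : ℝ) *
    Nat.card (Set.range s) = Nat.card ((Fin k → Fin σ) ≃ Fin (σ ^ k)) := by exact_mod_cast h0
  have h1' : ((Nat.card {ρ : (Fin k → Fin σ) ≃ Fin (σ ^ k) //
    ∀ j, ρ (s (Fin.last w)) ≤ ρ (s j)} : ℕ) : ℝ) *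
    Nat.card (Set.range s) = Nat.card ((Fin k → Fin σ) ≃ Fin (σ ^ k)) := by exact_mod_cast h1
  unfold Pgc IsGC
  rw [← hs]
  split_ifs with hU
  · have : Nat.card {ρ : (Fin k → Fin σ) ≃ Fin (σ ^ k) // (∀ i, ρ (s 0) ≤ ρ (s i)) ∨
        ((∀ i, ρ (s (Fin.last w)) ≤ ρ (s i)) ∧ ∀ i, s i = s (Fin.last w) → i = Fin.last w)} =
        Nat.card {ρ : (Fin k → Fin σ) ≃ Fin (σ ^ k) // ∀ j, ρ (s 0) ≤ ρ (s j)} +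
        Nat.card {ρ : (Fin k → Fin σ) ≃ Fin (σ ^ k) // ∀ j, ρ (s (Fin.last w)) ≤ ρ (s j)} := by
      have hU' : (∀ i, s i = s (Fin.last w) → i = Fin.last w) = True := eq_true hU
      rw [hU']
      simp only [and_true]
      simp only [Nat.card_eq_fintype_card]
      refine Fintype.card_subtype_or_disjoint _ _ ?_
      rw [Pi.disjoint_iff]
      intro ρ
      rw [Prop.disjoint_iff]
      intro hc
      have := hU 0 (ρ.injective (le_antisymm (hc.1 _) (hc.2 _)))
      simp [Fin.ext_iff] at this
      omega
    rw [this]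
    push_cast
    rw [div_eq_div_iff hT hR]
    linarith
  · have : ∀ ρ : (Fin k → Fin σ) ≃ Fin (σ ^ k), ((∀ i, ρ (s 0) ≤ ρ (s i)) ∨
        ((∀ i, ρ (s (Fin.last w)) ≤ ρ (s i)) ∧ ∀ i, s i = s (Fin.last w) → i = Fin.last w)) ↔
        (∀ i, ρ (s 0) ≤ ρ (s i)) := by
      intro ρ; tauto
    simp only [this]
    rw [div_eq_div_iff hT hR]
    linarith
end prob

theorem pgc_congr (σ k k' w : ℕ) (hw : 1 ≤ w) (v : Fin (w + k) → Fin σ) (u : Fin (w + k') → Fin σ)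
    (h : ∀ i j, kmerAt σ k w v i = kmerAt σ k w v j ↔ kmerAt σ k' w u i = kmerAt σ k' w u j) :
    Pgc σ k w v = Pgc σ k' w u := by
  rw [pgc_eq σ k w hw, pgc_eq σ k' w hw]
  have hk : Setoid.ker (kmerAt σ k w v) = Setoid.ker (kmerAt σ k' w u) := by
    ext i j; exact h i j
  have hc : Nat.card (Set.range (kmerAt σ k w v)) = Nat.card (Set.range (kmerAt σ k' w u)) := by
    rw [← Nat.card_congr (Setoid.quotientKerEquivRange _),
      ← Nat.card_congr (Setoid.quotientKerEquivRange (kmerAt σ k' w u)), hk]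
  rw [hc]
  simp only [h]

theorem ex_apply {n : ℕ} {A : Type*} [Zero A] (g : ℕ → A) (t : ℕ) (ht : t < n) :
    ex (fun i : Fin n => g i) t = g t := by simp [ex, ht]

theorem ex_inj {n : ℕ} {A : Type*} [Zero A] {v u : Fin n → A} (h : ∀ t < n, ex v t = ex u t) :
    v = u := by
  funext i
  simpa [ex] using h i i.2

theorem MinRep.le {A : Type*} {k w p : ℕ} {f : ℕ → A} (h : MinRep k w p f) : p ≤ w := by
  obtain ⟨i, hi, -⟩ := h.2.1
  omega

end GC12

open GC12 in
theorem stmt12 (σ k w : ℕ) (hσ : 2 ≤ σ) (hw : 1 ≤ w) (hwk : w ≤ k) :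
    ∃ φ : {v // v ∈ RepSet σ k w} ≃ {v // v ∈ RepSet σ (k + 1) w},
      ∀ v : {v // v ∈ RepSet σ k w}, Pgc σ k w v.1 = Pgc σ (k + 1) w (φ v).1 := by
  haveI : NeZero σ := ⟨by omega⟩
  have hex : ∀ v : {v // v ∈ RepSet σ k w}, ∃ u : {v // v ∈ RepSet σ (k + 1) w},
      ∃ p, MinRep k w p (ex v.1) ∧ MinRep (k + 1) w p (ex u.1) ∧
        Rl k w p (ex v.1) (ex u.1) := by
    rintro ⟨v, hv⟩
    obtain ⟨p, hp⟩ := (rep_iff v).1 hv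
    obtain ⟨g, hg⟩ := Rl.exists_right w (ex v) hp.1 (hp.le.trans hwk)
    have hg' : Rl k w p (ex v) (ex (fun i : Fin (w + (k + 1)) => g i)) :=
      hg.congr hw (fun _ _ => rfl) (fun t ht => ex_apply g t ht)
    have hm := (hg'.minRep hwk).1 hp
    exact ⟨⟨_, (rep_iff _).2 ⟨p, hm⟩⟩, p, hp, hm, hg'⟩
  choose φ hφ using hex
  have hbij : Function.Bijective φ := by
    constructor
    · intro v v' hvv
      obtain ⟨p, a1, a2, a3⟩ := hφ v
      obtain ⟨p', b1, b2, b3⟩ := hφ v'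
      rw [← hvv] at b2 b3
      obtain rfl := a2.unique b2
      exact Subtype.ext (ex_inj (a3.left_unique b3 a1.1 (a1.le.trans hwk)))
    · rintro ⟨u, hu⟩
      obtain ⟨p, hp⟩ := (rep_iff u).1 hu
      have hpk := hp.le.trans hwk
      have hk : ex u k = ex u (k - p) := by
        obtain ⟨i, hi, e⟩ := hp.2.1
        have := e.stp (k - p) (by omega) (by omega)
        rw [this]; congr 1; omega
      obtain ⟨f, hf⟩ := Rl.exists_left w (ex u) hp.1 hpk hk
      have hf' : Rl k w p (ex (fun i : Fin (w + k) => f i)) (ex u) :=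
        hf.congr hw (fun t ht => ex_apply f t ht) (fun _ _ => rfl)
      have hm := (hf'.minRep hwk).2 hp
      refine ⟨⟨_, (rep_iff _).2 ⟨p, hm⟩⟩, ?_⟩
      obtain ⟨p', b1, b2, b3⟩ := hφ ⟨_, (rep_iff _).2 ⟨p, hm⟩⟩
      obtain rfl := hm.unique b1
      exact Subtype.ext (ex_inj (b3.right_unique hf' hp.1 hpk))
  refine ⟨Equiv.ofBijective φ hbij, fun v => ?_⟩
  obtain ⟨p, a1, a2, a3⟩ := hφ v
  refine pgc_congr σ k (k + 1) w hw _ _ fun i j => ?_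
  rw [kmer_iff, kmer_iff]
  exact a3.pat hwk a1 (by omega) (by omega)
end
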